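/- (Proposition 3.2, curvature part.) Let α be a smooth curve in the Galilean 3-space G₃ parametrized by Galilean arc length, with Galilean Frenet frame {T, N, B}, curvature κ and torsion τ, and let φ(s,t) = α(s) + tN(s) be the normal surface along α. Then the Gaussian curvature of φ satisfies K(s,t) = −τ(s)² for all (s,t) ∈ I × ℝ; in particular K ≤ 0 everywhere, so the normal surface along a geodesic is either a surface of negative curvature or flat. -/

import Mathlib

noncomputable section

/-- The Galilean cross product of two vectors in `G₃` (modeled on `Fin 3 → ℝ`):
`x ∧ y = (0, x₃y₁ − x₁y₃, x₁y₂ − x₂y₁)`. -/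
def gcross (x y : Fin 3 → ℝ) : Fin 3 → ℝ :=
  ![0, x 2 * y 0 - x 0 * y 2, x 0 * y 1 - x 1 * y 0]

/-- The Galilean scalar product of two isotropic vectors: the Euclidean dot product
of their last two components. -/
def gdot (x y : Fin 3 → ℝ) : ℝ := x 1 * y 1 + x 2 * y 2

/-- The Galilean norm of an isotropic vector. -/
def gnorm (x : Fin 3 → ℝ) : ℝ := Real.sqrt (gdot x x)

/-- Partial derivative of a parametrized surface with respect to the first parameter. -/
def pderivS (φ : ℝ → ℝ → (Fin 3 → ℝ)) (s t : ℝ) : Fin 3 → ℝ :=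
  deriv (fun u => φ u t) s

/-- Partial derivative of a parametrized surface with respect to the second parameter. -/
def pderivT (φ : ℝ → ℝ → (Fin 3 → ℝ)) (s t : ℝ) : Fin 3 → ℝ :=
  deriv (fun v => φ s v) t

/-- `w = ‖φ_s ∧ φ_t‖`, the Galilean norm of the cross product of the partials. -/
def wfun (φ : ℝ → ℝ → (Fin 3 → ℝ)) (s t : ℝ) : ℝ :=
  gnorm (gcross (pderivS φ s t) (pderivT φ s t))

/-- The unit isotropic normal `η = (φ_s ∧ φ_t)/w` of the surface `φ`. -/
def unitNormal (φ : ℝ → ℝ → (Fin 3 → ℝ)) (s t : ℝ) : Fin 3 → ℝ :=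
  (wfun φ s t)⁻¹ • gcross (pderivS φ s t) (pderivT φ s t)

/-- Second fundamental form coefficient `L₁₁ = ⟨φ_ss, η⟩`. -/
def L11 (φ : ℝ → ℝ → (Fin 3 → ℝ)) (s t : ℝ) : ℝ :=
  gdot (pderivS (pderivS φ) s t) (unitNormal φ s t)

/-- Second fundamental form coefficient `L₁₂ = ⟨φ_st, η⟩`. -/
def L12 (φ : ℝ → ℝ → (Fin 3 → ℝ)) (s t : ℝ) : ℝ :=
  gdot (pderivS (pderivT φ) s t) (unitNormal φ s t)

/-- Second fundamental form coefficient `L₂₂ = ⟨φ_tt, η⟩`. -/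
def L22 (φ : ℝ → ℝ → (Fin 3 → ℝ)) (s t : ℝ) : ℝ :=
  gdot (pderivT (pderivT φ) s t) (unitNormal φ s t)

/-- Gaussian curvature `K = (L₁₁L₂₂ − L₁₂²)/w²`. -/
def Kgauss (φ : ℝ → ℝ → (Fin 3 → ℝ)) (s t : ℝ) : ℝ :=
  (L11 φ s t * L22 φ s t - (L12 φ s t) ^ 2) / (wfun φ s t) ^ 2

/-- Mean curvature of the ruled surface `φ` (with `g₁ = 1`, `g₂ = 0`): `H = L₂₂/(2w²)`. -/
def Hmean (φ : ℝ → ℝ → (Fin 3 → ℝ)) (s t : ℝ) : ℝ :=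
  L22 φ s t / (2 * (wfun φ s t) ^ 2)

/-- Adding an isotropic vector to the first factor does not change its Galilean cross product
with an isotropic vector. -/
theorem gcross_add_smul_of_isotropic {x y z : Fin 3 → ℝ} (hy : y 0 = 0) (hz : z 0 = 0) (c : ℝ) :
    gcross (x + c • y) z = gcross x z := by
  simp [gcross, hy, hz]

theorem pderivT_ruled {φ : ℝ → ℝ → (Fin 3 → ℝ)} {α N : ℝ → (Fin 3 → ℝ)}
    (hφ : ∀ s t : ℝ, φ s t = α s + t • N s) :
    pderivT φ = fun s _ => N s := by
  funext s t
  have h : HasDerivAt (fun v : ℝ => α s + v • N s) ((1 : ℝ) • N s) t :=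
    ((hasDerivAt_id t).smul_const (N s)).const_add (α s)
  simpa [pderivT, hφ] using h.deriv

theorem pderivS_ruled {φ : ℝ → ℝ → (Fin 3 → ℝ)} {α N : ℝ → (Fin 3 → ℝ)}
    (hφ : ∀ s t : ℝ, φ s t = α s + t • N s) {s : ℝ} {a n : Fin 3 → ℝ}
    (hα : HasDerivAt α a s) (hN : HasDerivAt N n s) (t : ℝ) :
    pderivS φ s t = a + t • n := by
  simp only [pderivS, hφ]
  exact (hα.add (hN.const_smul t)).deriv

theorem normal_surface_gaussian_curvature
    (I : Set ℝ) (hI : ∃ a b : ℝ, I = Set.Ioo a b)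
    (α T N B : ℝ → (Fin 3 → ℝ)) (κ τ : ℝ → ℝ)
    (hαsm : ContDiffOn ℝ (⊤ : ℕ∞) α I) (hNsm : ContDiffOn ℝ (⊤ : ℕ∞) N I) (hBsm : ContDiffOn ℝ (⊤ : ℕ∞) B I)
    (hκsm : ContDiffOn ℝ (⊤ : ℕ∞) κ I) (hτsm : ContDiffOn ℝ (⊤ : ℕ∞) τ I)
    (hα0 : ∀ s ∈ I, α s 0 = s)
    (hT : ∀ s ∈ I, HasDerivAt α (T s) s)
    (hNiso : ∀ s ∈ I, N s 0 = 0) (hBiso : ∀ s ∈ I, B s 0 = 0)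
    (hNunit : ∀ s ∈ I, gdot (N s) (N s) = 1) (hBunit : ∀ s ∈ I, gdot (B s) (B s) = 1)
    (hNB : ∀ s ∈ I, gdot (N s) (B s) = 0)
    (hBdef : ∀ s ∈ I, B s = gcross (T s) (N s))
    (hFrenetT : ∀ s ∈ I, HasDerivAt T (κ s • N s) s)
    (hFrenetN : ∀ s ∈ I, HasDerivAt N (τ s • B s) s)
    (hFrenetB : ∀ s ∈ I, HasDerivAt B ((-τ s) • N s) s)
    (φ : ℝ → ℝ → (Fin 3 → ℝ)) (hφ : ∀ s t : ℝ, φ s t = α s + t • N s)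
    :
    ∀ s ∈ I, ∀ t : ℝ,
      Kgauss φ s t = -(τ s) ^ 2 ∧ Kgauss φ s t ≤ 0 := by
  intro s hs t
  have hpT := pderivT_ruled hφ
  have hcross : gcross (pderivS φ s t) (pderivT φ s t) = B s := by
    rw [pderivS_ruled hφ (hT s hs) (hFrenetN s hs), hpT, smul_smul,
      gcross_add_smul_of_isotropic (hBiso s hs) (hNiso s hs), hBdef s hs]
  have hw : wfun φ s t = 1 := by
    rw [wfun, hcross, gnorm, hBunit s hs, Real.sqrt_one]
  have hη : unitNormal φ s t = B s := by
    rw [unitNormal, hw, hcross, inv_one, one_smul]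
  have h12 : L12 φ s t = τ s := by
    have hB := hBunit s hs
    rw [L12, hη, hpT, pderivS, (hFrenetN s hs).deriv]
    simp only [gdot, Pi.smul_apply, smul_eq_mul] at hB ⊢
    linear_combination τ s * hB
  have h22 : L22 φ s t = 0 := by
    rw [L22, hpT]
    simp [pderivT, gdot]
  have hK : Kgauss φ s t = -(τ s) ^ 2 := by
    rw [Kgauss, hw, h12, h22]
    ring
  exact ⟨hK, hK.trans_le (neg_nonpos.mpr (sq_nonneg _))⟩

end
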